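/- Let L be the Laplacian matrix of a strongly connected weighted digraph on N nodes, let ξ be the positive left eigenvector of L associated with eigenvalue 0 normalized so that ∑_i ξ_i = 1, and let R^{−1} = diag(1/ξ_1, …, 1/ξ_N). Let f_1, …, f_N : ℝ^n → ℝ be differentiable functions and let s* ∈ ℝ^n be the unique point at which ∑_{i=1}^N ∇f_i vanishes (s* is the unique optimal solution of min_{s} ∑_i f_i(s)). Let C and B be N×N diagonal matrices such that C + B has strictly positive diagonal entries. Suppose (x̄, v̄) ∈ ℝ^{N·n} × ℝ^{N·n} satisfies 0 = −(R^{−1} ⊗ I_n) ∇f̃(x̄) − ((C+B)L ⊗ I_n) x̄ − (L ⊗ I_n) v̄ and 0 = ((C+B)L ⊗ I_n) x̄, where ∇f̃(x̄) = col(∇f_1(x̄_1), …, ∇f_N(x̄_N)) and x̄ = col(x̄_1, …, x̄_N). Then x̄ = 𝟙_N ⊗ s*. -/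

import Mathlib

open Matrix

def IsAdjacencyMatrix {N : ℕ} (A : Matrix (Fin N) (Fin N) ℝ) : Prop :=
  (∀ i, A i i = 0) ∧ ∀ i j, 0 ≤ A i j

def IsStronglyConnected {N : ℕ} (A : Matrix (Fin N) (Fin N) ℝ) : Prop :=
  ∀ j i : Fin N, j ≠ i → ∃ (m : ℕ) (k : Fin (m + 1) → Fin N),
    k 0 = j ∧ k (Fin.last m) = i ∧
    ∀ t : Fin m, 0 < A (k t.succ) (k t.castSucc)

def laplacian {N : ℕ} (A : Matrix (Fin N) (Fin N) ℝ) : Matrix (Fin N) (Fin N) ℝ :=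
  Matrix.of fun i j => if i = j then ∑ k, A i k else -A i j

theorem lap_sum {N : ℕ} (A : Matrix (Fin N) (Fin N) ℝ) (hA : IsAdjacencyMatrix A)
    (y : Fin N → ℝ) (i : Fin N) :
    ∑ j, laplacian A i j * y j = ∑ j, A i j * (y i - y j) := by
  have h : ∀ j, laplacian A i j * y j = (if i = j then (∑ k, A i k) * y j else 0) - A i j * y j := by
    intro j
    by_cases hij : i = j
    · subst hij
      simp [laplacian, hA.1 i]
    · simp [laplacian, hij]
  simp only [h, mul_sub, Finset.sum_sub_distrib, Finset.sum_ite_eq, Finset.mem_univ, if_true,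
    Finset.sum_mul]

theorem lap_ker {N : ℕ} (A : Matrix (Fin N) (Fin N) ℝ) (hA : IsAdjacencyMatrix A)
    (hSC : IsStronglyConnected A) (y : Fin N → ℝ)
    (hy : ∀ i, ∑ j, laplacian A i j * y j = 0) (i j : Fin N) : y i = y j := by
  haveI : Nonempty (Fin N) := ⟨i⟩
  obtain ⟨m, hm⟩ := Finite.exists_max y
  have step : ∀ a b, y a = y m → 0 < A a b → y b = y m := by
    intro a b ha hab
    have h0 := hy a
    rw [lap_sum A hA] at h0
    have h1 := (Finset.sum_eq_zero_iff_of_nonneg (fun k _ =>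
      mul_nonneg (hA.2 a k) (by rw [ha]; linarith [hm k]))).1 h0 b (Finset.mem_univ b)
    rcases mul_eq_zero.1 h1 with h2 | h2
    · linarith
    · linarith
  have key : ∀ a, y a = y m := by
    intro a
    by_cases ham : a = m
    · rw [ham]
    obtain ⟨l, k, hk0, hkl, hk⟩ := hSC a m ham
    have : ∀ t : Fin (l + 1), y (k t) = y m := by
      intro t
      induction t using Fin.reverseInduction with
      | last => rw [hkl]
      | cast t ih => exact step _ _ ih (hk t)
    rw [← hk0]
    exact this 0
  rw [key i, key j]

/-- optimality condition: if `(x̄, v̄)` satisfies, blockwise,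
`0 = -(R⁻¹ ⊗ I_n) ∇f̃(x̄) - ((C+B)L ⊗ I_n) x̄ - (L ⊗ I_n) v̄` and
`0 = ((C+B)L ⊗ I_n) x̄`, where `C`, `B` are diagonal with `C + B` having
strictly positive diagonal entries `c i + b i`, and `s*` is the unique point
where `∑ i, ∇f i` vanishes, then `x̄ = 𝟙_N ⊗ s*`, i.e. `x̄ i = s*` for all `i`.
Block `i` of `((C+B)L ⊗ I_n) x̄` is `(c i + b i) • ∑ j, L i j • x̄ j`, and block
`i` of `(R⁻¹ ⊗ I_n) ∇f̃(x̄)` is `(ξ i)⁻¹ • ∇f_i(x̄_i)`. -/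
theorem optimality_condition_forces_consensus_at_optimum
    {N n : ℕ} (hN : 2 ≤ N) (hn : 1 ≤ n) (A : Matrix (Fin N) (Fin N) ℝ)
    (hA : IsAdjacencyMatrix A) (hSC : IsStronglyConnected A)
    (ξ : Fin N → ℝ) (hpos : ∀ i, 0 < ξ i) (hsum : ∑ i, ξ i = 1)
    (hleft : ξ ᵥ* laplacian A = 0)
    (f : Fin N → EuclideanSpace ℝ (Fin n) → ℝ)
    (g : Fin N → EuclideanSpace ℝ (Fin n) → EuclideanSpace ℝ (Fin n))
    (hgrad : ∀ i x, HasGradientAt (f i) (g i x) x)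
    (sstar : EuclideanSpace ℝ (Fin n))
    (hopt : ∑ i, g i sstar = 0)
    (huniq : ∀ s : EuclideanSpace ℝ (Fin n), ∑ i, g i s = 0 → s = sstar)
    (c b : Fin N → ℝ) (hcb : ∀ i, 0 < c i + b i)
    (xbar vbar : Fin N → EuclideanSpace ℝ (Fin n))
    (heq1 : ∀ i, (0 : EuclideanSpace ℝ (Fin n)) =
      -((ξ i)⁻¹ • g i (xbar i)) - (c i + b i) • (∑ j, laplacian A i j • xbar j)
        - ∑ j, laplacian A i j • vbar j)
    (heq2 : ∀ i, (c i + b i) • (∑ j, laplacian A i j • xbar j) =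
      (0 : EuclideanSpace ℝ (Fin n))) :
    ∀ i, xbar i = sstar := by
  have hL : ∀ i, ∑ j, laplacian A i j • xbar j = 0 := fun i =>
    (smul_eq_zero.1 (heq2 i)).resolve_left (hcb i).ne'
  have hcons : ∀ i j, xbar i = xbar j := by
    intro i j
    ext p
    refine lap_ker A hA hSC (fun i => xbar i p) ?_ i j
    intro a
    have := congrArg (fun v : EuclideanSpace ℝ (Fin n) => v p) (hL a)
    simpa using this
  have hg : ∀ i, g i (xbar i) = -(ξ i • ∑ j, laplacian A i j • vbar j) := by
    intro i
    have h := heq1 i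
    rw [heq2 i, sub_zero] at h
    have h2 : (ξ i)⁻¹ • g i (xbar i) = -∑ j, laplacian A i j • vbar j := by
      have h3 := sub_eq_zero.1 h.symm
      rw [← h3, neg_neg]
    rw [← smul_neg, ← h2, smul_smul, mul_inv_cancel₀ (hpos i).ne', one_smul]
  have hz : ∑ i, ξ i • ∑ j, laplacian A i j • vbar j = 0 := by
    simp only [Finset.smul_sum, smul_smul]
    rw [Finset.sum_comm]
    refine Finset.sum_eq_zero fun j _ => ?_
    rw [← Finset.sum_smul]
    have : ∑ i, ξ i * laplacian A i j = 0 := congrFun hleft j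
    rw [this, zero_smul]
  intro i
  apply huniq
  calc ∑ k, g k (xbar i) = ∑ k, g k (xbar k) :=
        Finset.sum_congr rfl fun k _ => by rw [hcons i k]
    _ = 0 := by simp only [hg, Finset.sum_neg_distrib, hz, neg_zero]
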